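/- arXiv:hep-th/0010199 — 3 statements merged into one kernel-verified Lean document; each statement's English description precedes it below -/
import Mathlib

section
/- Let L > 0 and let t ↦ Tr_D(t) := Σ_{n=1}^∞ exp(−t·n²π²/L²) be the heat trace of −d²/dx² on the interval [0,L] with Dirichlet boundary conditions at both endpoints (whose eigenvalues are n²π²/L² for n = 1, 2, 3, …). Then the series converges for every t > 0, and lim_{t→0⁺} ( Tr_D(t) − L/(2√(πt)) ) = −1/2. -/
open Real Set Filter

lemma hasSum_exp_neg_pi_mul_nat_succ {s : ℝ} (hs : 0 < s) :
    HasSum (fun n : ℕ => exp (-(π * s)) ^ (n + 1)) (exp (π * s) - 1)⁻¹ := by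
  have hlt : exp (-(π * s)) < 1 := exp_lt_one_iff.2 (neg_neg_of_pos (mul_pos pi_pos hs))
  have h := (hasSum_geometric_of_lt_one (exp_pos _).le hlt).mul_left (exp (-(π * s)))
  simp_rw [← pow_succ'] at h
  have heq : (exp (π * s) - 1)⁻¹ = exp (-(π * s)) * (1 - exp (-(π * s)))⁻¹ := by
    rw [exp_neg, ← mul_inv, mul_sub, mul_inv_cancel₀ (exp_ne_zero _), mul_one]
  rwa [heq]

lemma exp_neg_pi_mul_succ_sq_le {s : ℝ} (hs : 0 < s) (n : ℕ) :
    exp (-π * s * ((n : ℝ) + 1) ^ 2) ≤ exp (-(π * s)) ^ (n + 1) := by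
  rw [← exp_nat_mul, exp_le_exp]
  push_cast
  have := mul_pos pi_pos hs
  have hn : (0 : ℝ) ≤ n := n.cast_nonneg
  nlinarith [mul_nonneg this.le (mul_nonneg hn (add_nonneg hn zero_le_one))]

lemma summable_exp_neg_pi_mul_succ_sq {s : ℝ} (hs : 0 < s) :
    Summable fun n : ℕ => exp (-π * s * ((n : ℝ) + 1) ^ 2) :=
  .of_nonneg_of_le (fun _ => (exp_pos _).le) (exp_neg_pi_mul_succ_sq_le hs)
    (hasSum_exp_neg_pi_mul_nat_succ hs).summable

lemma tsum_exp_neg_pi_mul_succ_sq_le {s : ℝ} (hs : 0 < s) :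
    ∑' n : ℕ, exp (-π * s * ((n : ℝ) + 1) ^ 2) ≤ (π * s)⁻¹ := by
  have h := hasSum_exp_neg_pi_mul_nat_succ hs
  refine ((summable_exp_neg_pi_mul_succ_sq hs).tsum_mono h.summable
    (exp_neg_pi_mul_succ_sq_le hs)).trans ?_
  rw [h.tsum_eq]
  have := mul_pos pi_pos hs
  exact inv_anti₀ this (by linarith [add_one_le_exp (π * s)])

lemma tsum_int_exp_neg_pi_mul_sq {s : ℝ} (hs : 0 < s) :
    ∑' n : ℤ, exp (-π * s * (n : ℝ) ^ 2) =
      1 + 2 * ∑' n : ℕ, exp (-π * s * ((n : ℝ) + 1) ^ 2) := by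
  have hsum := (summable_exp_neg_pi_mul_succ_sq hs).hasSum
  have hnat : HasSum (fun n : ℕ => exp (-π * s * (((n : ℕ) : ℤ) : ℝ) ^ 2))
      (1 + ∑' n : ℕ, exp (-π * s * ((n : ℝ) + 1) ^ 2)) := by
    rw [← hasSum_nat_add_iff' 1]
    simpa using hsum
  have hneg : HasSum (fun n : ℕ => exp (-π * s * ((-((n : ℤ) + 1) : ℤ) : ℝ) ^ 2))
      (∑' n : ℕ, exp (-π * s * ((n : ℝ) + 1) ^ 2)) := by
    convert hsum using 3 with n
    push_cast
    ring
  rw [(HasSum.of_nat_of_neg_add_one (f := fun n : ℤ => exp (-π * s * (n : ℝ) ^ 2))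
    hnat hneg).tsum_eq]
  ring

/-- The functional equation of the theta function, for the sum over positive integers. -/
lemma tsum_exp_neg_pi_mul_succ_sq_sub {s : ℝ} (hs : 0 < s) :
    ∑' n : ℕ, exp (-π * s * ((n : ℝ) + 1) ^ 2) - 1 / (2 * √s) =
      -(1 / 2) + (∑' n : ℕ, exp (-π * s⁻¹ * ((n : ℝ) + 1) ^ 2)) / √s := by
  have h := Real.tsum_exp_neg_mul_int_sq hs
  simp_rw [div_eq_mul_inv (-π) s] at h
  rw [tsum_int_exp_neg_pi_mul_sq hs, tsum_int_exp_neg_pi_mul_sq (inv_pos.2 hs),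
    ← sqrt_eq_rpow] at h
  linear_combination h / 2

lemma tendsto_tsum_exp_neg_pi_mul_succ_sq_sub :
    Tendsto (fun s : ℝ => ∑' n : ℕ, exp (-π * s * ((n : ℝ) + 1) ^ 2) - 1 / (2 * √s))
      (nhdsWithin 0 (Ioi 0)) (nhds (-(1 / 2))) := by
  have hrem : Tendsto (fun s : ℝ => (∑' n : ℕ, exp (-π * s⁻¹ * ((n : ℝ) + 1) ^ 2)) / √s)
      (nhdsWithin 0 (Ioi 0)) (nhds 0) := by
    have hsqrt : Tendsto (fun s : ℝ => √s / π) (nhdsWithin 0 (Ioi 0)) (nhds 0) := by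
      have : Continuous fun s : ℝ => √s / π := by fun_prop
      simpa using (this.tendsto 0).mono_left nhdsWithin_le_nhds
    refine squeeze_zero' (.of_forall fun s => ?_) ?_ hsqrt
    · exact div_nonneg (tsum_nonneg fun _ => (exp_pos _).le) (sqrt_nonneg s)
    · filter_upwards [self_mem_nhdsWithin] with s (hs : 0 < s)
      rw [div_le_iff₀ (sqrt_pos.2 hs), div_mul_eq_mul_div, mul_self_sqrt hs.le]
      refine (tsum_exp_neg_pi_mul_succ_sq_le (inv_pos.2 hs)).trans_eq ?_
      field_simp
  have h := hrem.const_add (-(1 / 2))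
  rw [add_zero] at h
  refine h.congr' ?_
  filter_upwards [self_mem_nhdsWithin] with s (hs : 0 < s)
  exact (tsum_exp_neg_pi_mul_succ_sq_sub hs).symm

/-- Heat trace of `-d²/dx²` on `[0,L]` with Dirichlet conditions at both ends:
the series `Σ_{n≥1} exp(-t n²π²/L²)` converges for all `t > 0` and
`Tr_D(t) - L/(2√(πt)) → -1/2` as `t → 0⁺`. -/
theorem heat_trace_dirichlet_interval (L : ℝ) (hL : 0 < L) :
    (∀ t : ℝ, 0 < t →
      Summable fun n : ℕ =>
        Real.exp (-(t * ((n : ℝ) + 1) ^ 2 * π ^ 2 / L ^ 2)))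
    ∧
    Tendsto
      (fun t : ℝ =>
        (∑' n : ℕ, Real.exp (-(t * ((n : ℝ) + 1) ^ 2 * π ^ 2 / L ^ 2)))
          - L / (2 * Real.sqrt (π * t)))
      (nhdsWithin 0 (Ioi 0)) (nhds (-(1 / 2))) := by
  have hscale (t : ℝ) (n : ℕ) : -(t * ((n : ℝ) + 1) ^ 2 * π ^ 2 / L ^ 2) =
      -π * (π * t / L ^ 2) * ((n : ℝ) + 1) ^ 2 := by ring
  have hpos {t : ℝ} (ht : 0 < t) : 0 < π * t / L ^ 2 := by positivity
  simp_rw [hscale]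
  refine ⟨fun t ht => summable_exp_neg_pi_mul_succ_sq (hpos ht), ?_⟩
  have hlim : Tendsto (fun t : ℝ => π * t / L ^ 2)
      (nhdsWithin 0 (Ioi 0)) (nhdsWithin 0 (Ioi 0)) := by
    refine tendsto_nhdsWithin_iff.2 ⟨?_, ?_⟩
    · have : Continuous fun t : ℝ => π * t / L ^ 2 := by fun_prop
      simpa using (this.tendsto 0).mono_left nhdsWithin_le_nhds
    · filter_upwards [self_mem_nhdsWithin] with t ht using hpos ht
  refine (tendsto_tsum_exp_neg_pi_mul_succ_sq_sub.comp hlim).congr fun t => ?_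
  rw [Function.comp_apply, sqrt_div' _ (sq_nonneg L), sqrt_sq hL.le, ← mul_div_assoc 2,
    one_div_div]
end

section
/- Let t > 0 and let λ : ℕ → [0,∞) and μ : ℕ → [0,∞) be sequences such that (exp(−t·λ_i))_i and (exp(−t·μ_j))_j are summable for all t > 0. Suppose there is a bijection σ between the index sets {i : λ_i ≠ 0} and {j : μ_j ≠ 0} such that μ_{σ(i)} = λ_i for all i with λ_i ≠ 0. Then the sets {i : λ_i = 0} and {j : μ_j = 0} are finite, and for every t > 0, Σ_i exp(−t·λ_i) − Σ_j exp(−t·μ_j) = #{i : λ_i = 0} − #{j : μ_j = 0}; in particular this difference of heat traces is an integer independent of t. -/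
open Set

/-- If the heat trace of `a` converges at some time, then `a` has finitely many zeros. -/
theorem finite_zeros_of_summable_exp {ι : Type*} {a : ι → ℝ} {t : ℝ}
    (h : Summable fun i => Real.exp (-(t * a i))) : {i | a i = 0}.Finite := by
  have hev := h.tendsto_cofinite_zero.eventually (gt_mem_nhds one_pos)
  refine (Filter.eventually_cofinite.mp hev).subset fun i (hi : a i = 0) => ?_
  simp [hi]

/-- A heat trace is the number of zero modes plus the contribution of the nonzero modes. -/
theorem tsum_exp_eq_ncard_zeros_add {ι : Type*} {a : ι → ℝ} {t : ℝ}
    (h : Summable fun i => Real.exp (-(t * a i))) :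
    ∑' i, Real.exp (-(t * a i)) =
      ({i | a i = 0}.ncard : ℝ) + ∑' i : {i // a i ≠ 0}, Real.exp (-(t * a i)) := by
  have hzero : ∑' i : {i | a i = 0}, Real.exp (-(t * a i)) = ({i | a i = 0}.ncard : ℝ) := by
    have hone (i : {i | a i = 0}) : Real.exp (-(t * a i)) = 1 := by
      simp [show a i = 0 from i.2]
    simp only [hone, tsum_const, nsmul_eq_mul, mul_one, Nat.card_coe_set_eq]
  rw [← h.tsum_subtype_add_tsum_subtype_compl {i | a i = 0}, hzero]
  rfl

/-- Bott's cancellation argument: if the nonzero eigenvalues of two nonnegative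
spectra agree via a bijection, then both kernels are finite and the difference
of heat traces equals the (integer) difference of kernel dimensions for all
`t > 0`. -/
theorem bott_cancellation (lam mu : ℕ → ℝ)
    (hlam0 : ∀ i, 0 ≤ lam i) (hmu0 : ∀ j, 0 ≤ mu j)
    (hlam : ∀ t : ℝ, 0 < t → Summable fun i : ℕ => Real.exp (-(t * lam i)))
    (hmu : ∀ t : ℝ, 0 < t → Summable fun j : ℕ => Real.exp (-(t * mu j)))
    (σ : {i : ℕ // lam i ≠ 0} ≃ {j : ℕ // mu j ≠ 0})
    (hσ : ∀ i : {i : ℕ // lam i ≠ 0}, mu (σ i).1 = lam i.1) :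
    ({i : ℕ | lam i = 0}).Finite ∧ ({j : ℕ | mu j = 0}).Finite ∧
    ∀ t : ℝ, 0 < t →
      (∑' i : ℕ, Real.exp (-(t * lam i))) - (∑' j : ℕ, Real.exp (-(t * mu j)))
        = (({i : ℕ | lam i = 0}).ncard : ℝ) - (({j : ℕ | mu j = 0}).ncard : ℝ) := by
  refine ⟨finite_zeros_of_summable_exp (hlam 1 one_pos),
    finite_zeros_of_summable_exp (hmu 1 one_pos), fun t ht => ?_⟩
  have hnonzero : ∑' i : {i // lam i ≠ 0}, Real.exp (-(t * lam i)) =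
      ∑' j : {j // mu j ≠ 0}, Real.exp (-(t * mu j)) := by
    rw [← σ.tsum_eq]
    simp only [hσ]
  rw [tsum_exp_eq_ncard_zeros_add (hlam t ht), tsum_exp_eq_ncard_zeros_add (hmu t ht), hnonzero]
  ring
end

section
/- Let n be a nonnegative integer and set ν := n + 1. The function θ ↦ sin²(νθ)/sin³θ is integrable on every interval [ε, π−ε] with 0 < ε < π/2, and for every δ ∈ (0, π/2) there exists a constant C > 0 such that for all ε ∈ (0, δ): | ∫_ε^{π−ε} sin²(νθ)/sin³θ dθ − ∫_δ^{π−δ} sin²(νθ)/sin³θ dθ − 2ν²·log(δ/ε) | ≤ C·δ. In particular the integral ∫_0^π sin²(νθ)/sin³θ dθ diverges. -/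
open Real Set MeasureTheory intervalIntegral

theorem sub_sin_le_two_mul_cube {x : ℝ} (hx : 0 < x) : x - Real.sin x ≤ 2 * x ^ 3 := by
  rcases le_total x 1 with h | h
  · have := Real.sin_gt_sub_cube hx
    have : 0 < x ^ 3 := by positivity
    grind
  · nlinarith [Real.neg_one_le_sin x, pow_le_pow_right₀ h (show 1 ≤ 3 by norm_num)]

theorem sq_sub_sin_sq_le {x : ℝ} (hx : 0 < x) :
    |x ^ 2 - Real.sin x ^ 2| ≤ 4 * x ^ 4 := by
  have h1 := sub_sin_le_two_mul_cube hx
  have h2 := Real.sin_lt hx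
  have h3 : |x + Real.sin x| ≤ 2 * x := by
    have := abs_le.1 (Real.abs_sin_le_abs (x := x))
    rw [abs_of_pos hx] at this
    rw [abs_le]
    constructor <;> linarith [this.1]
  calc |x ^ 2 - Real.sin x ^ 2| = (x - Real.sin x) * |x + Real.sin x| := by
        rw [sq_sub_sq, mul_comm, abs_mul, abs_of_pos (sub_pos.2 h2)]
    _ ≤ 2 * x ^ 3 * (2 * x) := by gcongr
    _ = 4 * x ^ 4 := by ring

theorem half_le_sin {x : ℝ} (hx : 0 ≤ x) (hx' : x ≤ π / 2) : x / 2 ≤ Real.sin x := by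
  have h := Real.mul_le_sin hx hx'
  have : 1 / 2 ≤ 2 / π := by
    rw [div_le_div_iff₀ two_pos Real.pi_pos]
    linarith [Real.pi_le_four]
  nlinarith

theorem abs_sin_sq_div_sin_cube_sub_le {ν x : ℝ} (hν : 0 < ν) (hx : 0 < x) (hx' : x ≤ π / 2) :
    |Real.sin (ν * x) ^ 2 / Real.sin x ^ 3 - ν ^ 2 * x⁻¹| ≤ 16 * (4 * ν ^ 4 + 6 * ν ^ 2) := by
  have hs := half_le_sin hx.le hx'
  have hs0 : 0 < Real.sin x := by linarith
  have hsx := Real.sin_lt hx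
  have h1 := sq_sub_sin_sq_le (mul_pos hν hx)
  have h2 : x ^ 3 - Real.sin x ^ 3 ≤ 6 * x ^ 5 := by
    calc x ^ 3 - Real.sin x ^ 3
        = (x - Real.sin x) * (x ^ 2 + x * Real.sin x + Real.sin x ^ 2) := by ring
      _ ≤ 2 * x ^ 3 * (x ^ 2 + x * x + x ^ 2) := by
        gcongr
        exact sub_sin_le_two_mul_cube hx
      _ = 6 * x ^ 5 := by ring
  have h2' : 0 ≤ x ^ 3 - Real.sin x ^ 3 := by
    have : Real.sin x ^ 3 ≤ x ^ 3 := by gcongr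
    linarith
  have hnum : |x * Real.sin (ν * x) ^ 2 - ν ^ 2 * Real.sin x ^ 3|
      ≤ (4 * ν ^ 4 + 6 * ν ^ 2) * x ^ 5 := by
    calc |x * Real.sin (ν * x) ^ 2 - ν ^ 2 * Real.sin x ^ 3|
        = |ν ^ 2 * (x ^ 3 - Real.sin x ^ 3) - x * ((ν * x) ^ 2 - Real.sin (ν * x) ^ 2)| := by
          ring_nf
      _ ≤ |ν ^ 2 * (x ^ 3 - Real.sin x ^ 3)| + |x * ((ν * x) ^ 2 - Real.sin (ν * x) ^ 2)| :=
          abs_sub _ _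
      _ = ν ^ 2 * (x ^ 3 - Real.sin x ^ 3) + x * |(ν * x) ^ 2 - Real.sin (ν * x) ^ 2| := by
          rw [abs_mul, abs_mul, abs_of_nonneg h2', abs_of_pos hx, abs_of_nonneg (sq_nonneg ν)]
      _ ≤ ν ^ 2 * (6 * x ^ 5) + x * (4 * (ν * x) ^ 4) := by gcongr
      _ = (4 * ν ^ 4 + 6 * ν ^ 2) * x ^ 5 := by ring
  have hden : x ^ 4 / 8 ≤ Real.sin x ^ 3 * x := by
    calc x ^ 4 / 8 = (x / 2) ^ 3 * x := by ring
      _ ≤ _ := by gcongr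
  have heq : Real.sin (ν * x) ^ 2 / Real.sin x ^ 3 - ν ^ 2 * x⁻¹
      = (x * Real.sin (ν * x) ^ 2 - ν ^ 2 * Real.sin x ^ 3) / (Real.sin x ^ 3 * x) := by
    field_simp
  rw [heq, abs_div, abs_of_pos (by positivity : 0 < Real.sin x ^ 3 * x),
    div_le_iff₀ (by positivity)]
  have hx2 : x ≤ 2 := by linarith [Real.pi_le_four]
  calc _ ≤ (4 * ν ^ 4 + 6 * ν ^ 2) * x ^ 5 := hnum
    _ = (4 * ν ^ 4 + 6 * ν ^ 2) * (x ^ 4 * x) := by ring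
    _ ≤ (4 * ν ^ 4 + 6 * ν ^ 2) * (x ^ 4 * 2) := by gcongr
    _ = 16 * (4 * ν ^ 4 + 6 * ν ^ 2) * (x ^ 4 / 8) := by ring
    _ ≤ _ := by gcongr

theorem intervalIntegrable_sin_sq_div_sin_cube (ν : ℝ) {a b : ℝ} (ha : 0 < a) (ha' : a < π)
    (hb : 0 < b) (hb' : b < π) :
    IntervalIntegrable (fun θ => Real.sin (ν * θ) ^ 2 / Real.sin θ ^ 3) volume a b := by
  refine ContinuousOn.intervalIntegrable (ContinuousOn.div (by fun_prop) (by fun_prop) ?_)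
  intro x hx
  exact pow_ne_zero 3 (Real.sin_pos_of_pos_of_lt_pi
    ((lt_min ha hb).trans_le hx.1) (hx.2.trans_lt (max_lt ha' hb'))).ne'

theorem sin_sq_div_sin_cube_pi_sub (n : ℕ) (θ : ℝ) :
    Real.sin ((n + 1 : ℝ) * (π - θ)) ^ 2 / Real.sin (π - θ) ^ 3
      = Real.sin ((n + 1 : ℝ) * θ) ^ 2 / Real.sin θ ^ 3 := by
  have h : Real.sin ((n + 1 : ℝ) * (π - θ)) ^ 2 = Real.sin ((n + 1 : ℝ) * θ) ^ 2 := by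
    have := Real.sin_nat_mul_pi_sub ((n + 1 : ℝ) * θ) (n + 1)
    push_cast at this
    rw [mul_sub, this, neg_sq, mul_pow, ← pow_mul, mul_comm (n + 1) 2, pow_mul]
    simp
  rw [h, Real.sin_pi_sub]

theorem not_intervalIntegrable_sin_sq_div_sin_cube {ν : ℝ} (hν : 1 ≤ ν) :
    ¬ IntervalIntegrable (fun θ => Real.sin (ν * θ) ^ 2 / Real.sin θ ^ 3) volume 0 π := by
  intro h
  have hν0 : 0 < ν := by linarith
  have hν1 : ν⁻¹ ≤ 1 := inv_le_one_of_one_le₀ hν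
  have hpi := Real.pi_gt_three
  have h1 : IntervalIntegrable (fun θ => Real.sin (ν * θ) ^ 2 / Real.sin θ ^ 3) volume 0 ν⁻¹ := by
    refine h.mono_set ?_
    rw [uIcc_of_le (by positivity), uIcc_of_le Real.pi_pos.le]
    exact Icc_subset_Icc_right (by linarith)
  have h2 : IntervalIntegrable (fun x : ℝ => x⁻¹) volume 0 ν⁻¹ := by
    refine (h1.const_mul 4).mono_fun' (by fun_prop) ?_
    filter_upwards [ae_restrict_mem measurableSet_uIoc] with x hx
    rw [uIoc_of_le (by positivity)] at hx
    obtain ⟨hx0, hx1⟩ := hx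
    have hνx : ν * x ≤ 1 := by
      calc ν * x ≤ ν * ν⁻¹ := by gcongr
        _ = 1 := mul_inv_cancel₀ hν0.ne'
    have hs0 : 0 < Real.sin x := Real.sin_pos_of_pos_of_lt_pi hx0 (by linarith)
    have hnum : (ν * x / 2) ^ 2 ≤ Real.sin (ν * x) ^ 2 := by
      gcongr
      exact half_le_sin (by positivity) (by linarith)
    have hnum' : x ^ 2 / 4 ≤ Real.sin (ν * x) ^ 2 := by
      refine le_trans ?_ hnum
      nlinarith [sq_nonneg x, mul_nonneg (sq_nonneg x) (show 0 ≤ ν ^ 2 - 1 by nlinarith)]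
    rw [Real.norm_of_nonneg (by positivity)]
    calc x⁻¹ = 4 * (x ^ 2 / 4 / x ^ 3) := by field_simp
      _ ≤ 4 * (Real.sin (ν * x) ^ 2 / Real.sin x ^ 3) := by
        gcongr
        exact Real.sin_le hx0.le
  rw [intervalIntegrable_inv_iff] at h2
  rcases h2 with h2 | h2
  · exact (inv_pos.2 hν0).ne h2
  · exact h2 left_mem_uIcc

theorem abs_integral_sin_sq_div_sin_cube_sub_log_le {ν ε δ : ℝ} (hν : 0 < ν) (hε : 0 < ε)
    (hεδ : ε ≤ δ) (hδ : δ ≤ π / 2) :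
    |(∫ θ in ε..δ, Real.sin (ν * θ) ^ 2 / Real.sin θ ^ 3) - ν ^ 2 * Real.log (δ / ε)|
      ≤ 16 * (4 * ν ^ 4 + 6 * ν ^ 2) * (δ - ε) := by
  have hpi := Real.pi_pos
  have hδ0 : 0 < δ := by linarith
  have hinv : IntervalIntegrable (fun θ : ℝ => ν ^ 2 * θ⁻¹) volume ε δ := by
    refine IntervalIntegrable.const_mul (intervalIntegrable_inv_iff.2 (Or.inr ?_)) _
    exact notMem_uIcc_of_lt hε hδ0
  rw [← integral_inv_of_pos hε hδ0, ← intervalIntegral.integral_const_mul,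
    ← intervalIntegral.integral_sub
      (intervalIntegrable_sin_sq_div_sin_cube ν hε (by linarith) hδ0 (by linarith)) hinv,
    ← abs_of_nonneg (sub_nonneg.2 hεδ), ← Real.norm_eq_abs]
  refine intervalIntegral.norm_integral_le_of_norm_le_const fun x hx => ?_
  rw [uIoc_of_le hεδ] at hx
  exact abs_sin_sq_div_sin_cube_sub_le hν (hε.trans hx.1) (hx.2.trans hδ)

theorem integral_sin_sq_div_sin_cube_sub (n : ℕ) {ε δ : ℝ} (hε : 0 < ε) (hε' : ε < π)
    (hδ : 0 < δ) (hδ' : δ < π) :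
    (∫ θ in ε..(π - ε), Real.sin ((n + 1 : ℝ) * θ) ^ 2 / Real.sin θ ^ 3)
      - (∫ θ in δ..(π - δ), Real.sin ((n + 1 : ℝ) * θ) ^ 2 / Real.sin θ ^ 3)
      = 2 * ∫ θ in ε..δ, Real.sin ((n + 1 : ℝ) * θ) ^ 2 / Real.sin θ ^ 3 := by
  have hi {a b : ℝ} (ha : 0 < a) (ha' : a < π) (hb : 0 < b) (hb' : b < π) :=
    intervalIntegrable_sin_sq_div_sin_cube (n + 1 : ℝ) ha ha' hb hb'
  have hrefl : (∫ θ in (π - δ)..(π - ε), Real.sin ((n + 1 : ℝ) * θ) ^ 2 / Real.sin θ ^ 3)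
      = ∫ θ in ε..δ, Real.sin ((n + 1 : ℝ) * θ) ^ 2 / Real.sin θ ^ 3 := by
    rw [← intervalIntegral.integral_comp_sub_left
      (fun θ => Real.sin ((n + 1 : ℝ) * θ) ^ 2 / Real.sin θ ^ 3) π]
    simp only [sin_sq_div_sin_cube_pi_sub]
  have hδπ : 0 < π - δ := by linarith
  have hδπ' : π - δ < π := by linarith
  have hεπ : 0 < π - ε := by linarith
  have hεπ' : π - ε < π := by linarith
  rw [← intervalIntegral.integral_add_adjacent_intervals (hi hε hε' hδ hδ') (hi hδ hδ' hεπ hεπ'),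
    ← intervalIntegral.integral_add_adjacent_intervals (hi hδ hδ' hδπ hδπ')
      (hi hδπ hδπ' hεπ hεπ'), hrefl]
  ring

/-- Quantitative logarithmic divergence of the critical-mode integral: with
`ν = n + 1`, the function `θ ↦ sin²(νθ)/sin³θ` is integrable on `[ε, π-ε]`
for `0 < ε < π/2`; for every `δ ∈ (0, π/2)` there is `C > 0` so that for all
`ε ∈ (0, δ)` the integral over `[ε, π-ε]` differs from the integral over
`[δ, π-δ]` plus `2ν²·log(δ/ε)` by at most `C·δ`; and the integral over
`(0, π)` diverges. -/
theorem critical_mode_integral_quantitative (n : ℕ) :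
    (∀ ε : ℝ, 0 < ε → ε < π / 2 →
      IntervalIntegrable
        (fun θ => (Real.sin ((n + 1 : ℝ) * θ)) ^ 2 / (Real.sin θ) ^ 3)
        volume ε (π - ε))
    ∧
    (∀ δ : ℝ, 0 < δ → δ < π / 2 → ∃ C : ℝ, 0 < C ∧
      ∀ ε : ℝ, 0 < ε → ε < δ →
        |(∫ θ in ε..(π - ε), (Real.sin ((n + 1 : ℝ) * θ)) ^ 2 / (Real.sin θ) ^ 3)
          - (∫ θ in δ..(π - δ), (Real.sin ((n + 1 : ℝ) * θ)) ^ 2 / (Real.sin θ) ^ 3)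
          - 2 * (n + 1 : ℝ) ^ 2 * Real.log (δ / ε)| ≤ C * δ)
    ∧
    ¬ IntervalIntegrable
        (fun θ => (Real.sin ((n + 1 : ℝ) * θ)) ^ 2 / (Real.sin θ) ^ 3)
        volume 0 π := by
  have hν : (1 : ℝ) ≤ n + 1 := by simp
  have hν0 : (0 : ℝ) < n + 1 := by positivity
  refine ⟨fun ε hε hε' => ?_, fun δ hδ hδ' => ?_,
    not_intervalIntegrable_sin_sq_div_sin_cube hν⟩
  · exact intervalIntegrable_sin_sq_div_sin_cube _ hε (by linarith) (by linarith) (by linarith)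
  · refine ⟨2 * (16 * (4 * (n + 1 : ℝ) ^ 4 + 6 * (n + 1 : ℝ) ^ 2)), by positivity,
      fun ε hε hεδ => ?_⟩
    rw [integral_sin_sq_div_sin_cube_sub n hε (by linarith) hδ (by linarith), mul_assoc 2,
      ← mul_sub, abs_mul, abs_two, mul_assoc 2]
    have h := abs_integral_sin_sq_div_sin_cube_sub_log_le hν0 hε hεδ.le hδ'.le
    refine mul_le_mul_of_nonneg_left (h.trans ?_) two_pos.le
    gcongr
    linarith
end
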